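/- arXiv:2312.01647 — 8 statements merged into one kernel-verified Lean document; each statement's English description precedes it below -/
import Mathlib

section
/- Let S and T be finite sets of positive integers, and let x ∈ T be an element with x ∉ T ◁ S. Then (T − x) ◁ S = T ◁ S. -/
/-- The `◁` operator: `tri T S = T ◁ S`.  Iterate through the elements of `S` from
largest to smallest; the current element `s` picks the largest element of `T` that is
less than `s` and has not yet been picked (if such an element exists), and the picked
elements form `T ◁ S`. -/
def tri (T S : Finset ℕ) : Finset ℕ :=
  if hS : S.Nonempty then
    if hT : (T.filter (fun t => t < S.max' hS)).Nonempty then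
      insert ((T.filter (fun t => t < S.max' hS)).max' hT)
        (tri (T.filter (fun t => t < (T.filter (fun t => t < S.max' hS)).max' hT))
          (S.erase (S.max' hS)))
    else ∅
  else ∅
termination_by S.card
decreasing_by
  exact Finset.card_erase_lt_of_mem (S.max'_mem hS)

/-- `nth S i` is the `i`-th smallest element of `S` (1-based), i.e. `S(i)`. -/
def nth (S : Finset ℕ) (i : ℕ) : ℕ :=
  (S.sort (· ≤ ·)).getD (i - 1) 0

/-- `Dom T S` means `T ⪯ S`, i.e. `S` dominates `T`:
`|T| ≥ |S|` and `T(i) < S(i)` for all `1 ≤ i ≤ |S|`. -/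
def Dom (T S : Finset ℕ) : Prop :=
  S.card ≤ T.card ∧ ∀ i, 1 ≤ i → i ≤ S.card → nth T i < nth S i

theorem tri_erase_aux (n : ℕ) : ∀ (S T : Finset ℕ) (x : ℕ), S.card = n → x ∉ tri T S →
    tri (T.erase x) S = tri T S := by
  induction n with
  | zero =>
    intro S T x hn _
    have hS : ¬ S.Nonempty := by
      rw [Finset.card_eq_zero] at hn
      simp [hn]
    rw [tri, tri, dif_neg hS, dif_neg hS]
  | succ n ih =>
    intro S T x hn hx
    have hS : S.Nonempty := Finset.card_pos.mp (by omega)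
    rw [tri, dif_pos hS] at hx
    rw [tri, tri.eq_1 T S, dif_pos hS, dif_pos hS]
    by_cases hT : (T.filter (fun t => t < S.max' hS)).Nonempty
    · rw [dif_pos hT] at hx
      rw [dif_pos hT]
      rw [Finset.mem_insert, not_or] at hx
      obtain ⟨hxm, hx⟩ := hx
      have hm := Finset.max'_mem _ hT
      have hle : ∀ y ∈ T.filter (fun t => t < S.max' hS),
          y ≤ (T.filter (fun t => t < S.max' hS)).max' hT :=
        fun y hy => Finset.le_max' _ y hy
      generalize (T.filter (fun t => t < S.max' hS)).max' hT = m at *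
      have hm2 : m ∈ (T.erase x).filter (fun t => t < S.max' hS) := by
        simp only [Finset.mem_filter, Finset.mem_erase] at hm ⊢
        exact ⟨⟨Ne.symm hxm, hm.1⟩, hm.2⟩
      have hT2 : ((T.erase x).filter (fun t => t < S.max' hS)).Nonempty := ⟨m, hm2⟩
      have hmax : ((T.erase x).filter (fun t => t < S.max' hS)).max' hT2 = m := by
        apply le_antisymm
        · apply Finset.max'_le
          intro y hy
          apply hle
          simp only [Finset.mem_filter, Finset.mem_erase] at hy ⊢
          exact ⟨hy.1.2, hy.2⟩
        · exact Finset.le_max' _ _ hm2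
      rw [dif_pos hT2, hmax]
      have he : (T.erase x).filter (fun t => t < m) = (T.filter (fun t => t < m)).erase x := by
        ext y
        simp only [Finset.mem_filter, Finset.mem_erase]
        tauto
      rw [he, ih _ _ _ _ hx]
      rw [Finset.card_erase_of_mem (S.max'_mem hS)]
      omega
    · have hT2 : ¬ ((T.erase x).filter (fun t => t < S.max' hS)).Nonempty := by
        rintro ⟨y, hy⟩
        apply hT
        simp only [Finset.mem_filter, Finset.mem_erase] at hy
        exact ⟨y, Finset.mem_filter.mpr ⟨hy.1.2, hy.2⟩⟩
      rw [dif_neg hT, dif_neg hT2]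

theorem stmt0 (S T : Finset ℕ) (hSpos : ∀ a ∈ S, 0 < a) (hTpos : ∀ a ∈ T, 0 < a)
    (x : ℕ) (hxT : x ∈ T) (hx : x ∉ tri T S) :
    tri (T.erase x) S = tri T S := by
  exact tri_erase_aux _ S T x rfl hx
end

section
/- Let S, T, T' be finite sets of positive integers with T' ⊆ T and T ◁ S ⊆ T'. Then T ◁ S = T' ◁ S. -/
theorem tri_subset_aux (n : ℕ) : ∀ S T : Finset ℕ, S.card = n → tri T S ⊆ T := by
  induction n with
  | zero =>
    intro S T h
    rw [Finset.card_eq_zero] at h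
    subst h
    rw [tri]
    simp
  | succ n ih =>
    intro S T h
    rw [tri]
    split_ifs with hS hT
    · have h1 := Finset.max'_mem _ hT
      have h2 : (S.erase (S.max' hS)).card = n := by
        rw [Finset.card_erase_of_mem (S.max'_mem hS)]; omega
      refine Finset.insert_subset (Finset.mem_filter.1 h1).1 ?_
      exact (ih _ _ h2).trans (Finset.filter_subset _ _)
    · simp
    · simp

theorem stmt1_aux (n : ℕ) : ∀ S T T' : Finset ℕ, S.card = n → T' ⊆ T → tri T S ⊆ T' →
    tri T S = tri T' S := by
  induction n with
  | zero =>
    intro S T T' h _ _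
    rw [Finset.card_eq_zero] at h
    subst h
    rw [tri, tri]
    simp
  | succ n ih =>
    intro S T T' h hsub hsub'
    have hS : S.Nonempty := Finset.card_pos.1 (by omega)
    have h2 : (S.erase (S.max' hS)).card = n := by
      rw [Finset.card_erase_of_mem (S.max'_mem hS)]; omega
    by_cases hT : (T.filter (fun t => t < S.max' hS)).Nonempty
    · rw [tri, dif_pos hS, dif_pos hT] at hsub' ⊢
      have hm := Finset.mem_filter.1 (Finset.max'_mem _ hT)
      have hmT' := hsub' (Finset.mem_insert_self _ _)
      have hT' : (T'.filter (fun t => t < S.max' hS)).Nonempty :=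
        ⟨_, Finset.mem_filter.2 ⟨hmT', hm.2⟩⟩
      have hmax : (T'.filter (fun t => t < S.max' hS)).max' hT' =
          (T.filter (fun t => t < S.max' hS)).max' hT := by
        apply le_antisymm
        · exact Finset.max'_subset _ (Finset.filter_subset_filter _ hsub)
        · exact Finset.le_max' _ _ (Finset.mem_filter.2 ⟨hmT', hm.2⟩)
      rw [tri.eq_def T', dif_pos hS, dif_pos hT', hmax]
      congr 1
      apply ih _ _ _ h2 (Finset.filter_subset_filter _ hsub)
      intro x hx
      have h3 := tri_subset_aux n _ _ h2 hx
      exact Finset.mem_filter.2 ⟨hsub' (Finset.mem_insert_of_mem hx), (Finset.mem_filter.1 h3).2⟩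
    · have hT' : ¬ (T'.filter (fun t => t < S.max' hS)).Nonempty :=
        fun h => hT (h.mono (Finset.filter_subset_filter _ hsub))
      rw [tri, dif_pos hS, dif_neg hT, tri, dif_pos hS, dif_neg hT']

theorem stmt1 (S T T' : Finset ℕ) (hSpos : ∀ a ∈ S, 0 < a) (hTpos : ∀ a ∈ T, 0 < a)
    (hsub : T' ⊆ T) (hsub' : tri T S ⊆ T') :
    tri T S = tri T' S := by
  exact stmt1_aux _ S T T' rfl hsub hsub'
end

section
/- Let S and T be finite sets of positive integers and let x ∈ T ◁ S. If T_{<x} \ (T ◁ S) is empty, then (T − x) ◁ S = (T ◁ S) − x. Otherwise, letting x' = max(T_{<x} \ (T ◁ S)), one has (T − x) ◁ S = ((T ◁ S) − x) ⊔ x'. -/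
theorem tri_step (T S : Finset ℕ) (m p : ℕ) (hm : m ∈ S) (hmax : ∀ s ∈ S, s ≤ m)
    (hp : p ∈ T) (hpm : p < m) (hpmax : ∀ t ∈ T, t < m → t ≤ p) :
    tri T S = insert p (tri (T.filter (fun t => t < p)) (S.erase m)) := by
  have hS : S.Nonempty := ⟨m, hm⟩
  have e : S.max' hS = m := le_antisymm (Finset.max'_le _ _ _ hmax) (Finset.le_max' _ _ hm)
  have hT : (T.filter (fun t => t < S.max' hS)).Nonempty := ⟨p, by simp [e, hp, hpm]⟩
  have e2 : (T.filter (fun t => t < S.max' hS)).max' hT = p := by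
    apply le_antisymm
    · apply Finset.max'_le
      intro t ht
      rw [Finset.mem_filter, e] at ht
      exact hpmax t ht.1 ht.2
    · apply Finset.le_max'
      simp [e, hp, hpm]
  rw [tri, dif_pos hS, dif_pos hT, e2, e]

theorem tri_none (T S : Finset ℕ) (h : ∀ s ∈ S, ∀ t ∈ T, s ≤ t) : tri T S = ∅ := by
  rw [tri]
  split_ifs with hS hT
  · exfalso
    obtain ⟨t, ht⟩ := hT
    rw [Finset.mem_filter] at ht
    have := h _ (S.max'_mem hS) t ht.1
    omega
  · rfl
  · rfl

theorem tri_cases (T S : Finset ℕ) : (∀ s ∈ S, ∀ t ∈ T, s ≤ t) ∨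
    ∃ m p, m ∈ S ∧ (∀ s ∈ S, s ≤ m) ∧ p ∈ T ∧ p < m ∧ (∀ t ∈ T, t < m → t ≤ p) := by
  by_cases h : ∀ s ∈ S, ∀ t ∈ T, s ≤ t
  · exact Or.inl h
  · right
    push Not at h
    obtain ⟨s, hs, t, ht, hts⟩ := h
    obtain ⟨m, hm, hmax⟩ := Finset.exists_max_image S id ⟨s, hs⟩
    have hsm := hmax s hs
    simp only [id] at hsm hmax
    obtain ⟨p, hp, hpmax⟩ := Finset.exists_max_image (T.filter (fun t => t < m)) id
      ⟨t, by rw [Finset.mem_filter]; exact ⟨ht, by omega⟩⟩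
    rw [Finset.mem_filter] at hp
    refine ⟨m, p, hm, hmax, hp.1, hp.2, fun t ht htm => hpmax t ?_⟩
    rw [Finset.mem_filter]; exact ⟨ht, htm⟩

theorem tri_subset (n : ℕ) : ∀ (S T : Finset ℕ), S.card = n → tri T S ⊆ T := by
  induction n with
  | zero =>
    intro S T hc
    rw [Finset.card_eq_zero] at hc
    subst hc
    rw [tri_none _ _ (by simp)]; simp
  | succ n ih =>
    intro S T hc
    rcases tri_cases T S with h | ⟨m, p, hm, hmax, hp, hpm, hpmax⟩
    · rw [tri_none _ _ h]; simp
    · rw [tri_step T S m p hm hmax hp hpm hpmax]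
      have := ih (S.erase m) (T.filter (fun t => t < p)) (by rw [Finset.card_erase_of_mem hm]; omega)
      exact Finset.insert_subset hp (this.trans (Finset.filter_subset _ _))

theorem tri_erase_not_mem (n : ℕ) : ∀ (S T : Finset ℕ) (y : ℕ), S.card = n → y ∉ tri T S →
    tri (T.erase y) S = tri T S := by
  induction n with
  | zero =>
    intro S T y hc _
    rw [Finset.card_eq_zero] at hc
    subst hc
    rw [tri_none _ _ (by simp), tri_none _ _ (by simp)]
  | succ n ih =>
    intro S T y hc hy
    rcases tri_cases T S with h | ⟨m, p, hm, hmax, hp, hpm, hpmax⟩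
    · rw [tri_none _ _ h, tri_none]
      intro s hs t ht
      exact h s hs t (Finset.mem_of_mem_erase ht)
    · rw [tri_step T S m p hm hmax hp hpm hpmax] at hy ⊢
      rw [Finset.mem_insert, not_or] at hy
      rw [tri_step (T.erase y) S m p hm hmax (Finset.mem_erase.2 ⟨Ne.symm hy.1, hp⟩) hpm
        (fun t ht => hpmax t (Finset.mem_of_mem_erase ht)), Finset.filter_erase,
        ih _ _ _ (by rw [Finset.card_erase_of_mem hm]; omega) hy.2]

theorem tri_main (n : ℕ) : ∀ (S T : Finset ℕ) (x : ℕ), S.card = n → x ∈ tri T S →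
    ((∀ t ∈ T, t < x → t ∈ tri T S) → tri (T.erase x) S = (tri T S).erase x) ∧
    (∀ y ∈ T, y < x → y ∉ tri T S → (∀ t ∈ T, t < x → t ∉ tri T S → t ≤ y) →
      tri (T.erase x) S = insert y ((tri T S).erase x)) := by
  induction n with
  | zero =>
    intro S T x hc hx
    rw [Finset.card_eq_zero] at hc
    subst hc
    rw [tri_none _ _ (by simp)] at hx
    simp at hx
  | succ n ih =>
    intro S T x hc hx
    rcases tri_cases T S with h | ⟨m, p, hm, hmax, hp, hpm, hpmax⟩
    · rw [tri_none _ _ h] at hx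
      simp at hx
    have hc' : (S.erase m).card = n := by rw [Finset.card_erase_of_mem hm]; omega
    have hsub := tri_subset n (S.erase m) (T.filter (fun t => t < p)) hc'
    have hpn : p ∉ tri (T.filter (fun t => t < p)) (S.erase m) := by
      intro h
      have := hsub h
      simp at this
    have hlt : ∀ t ∈ tri (T.filter (fun t => t < p)) (S.erase m), t < p := by
      intro t h
      exact (Finset.mem_filter.1 (hsub h)).2
    rw [tri_step T S m p hm hmax hp hpm hpmax] at hx ⊢
    by_cases hxp : x = p
    · subst hxp
      rw [Finset.erase_insert hpn]
      rcases (T.filter (fun t => t < x)).eq_empty_or_nonempty with he | hne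
      · have h0 : tri (T.erase x) S = ∅ := by
          apply tri_none
          intro s hs t ht
          rw [Finset.mem_erase] at ht
          by_contra hlt
          have h1 := hmax s hs
          have h2 := hpmax t ht.2 (by omega)
          have : t ∈ T.filter (fun t => t < x) := Finset.mem_filter.2 ⟨ht.2, by omega⟩
          rw [he] at this
          simp at this
        rw [h0, he, tri_none ∅ _ (by simp)]
        refine ⟨fun _ => rfl, fun y hy hyx => ?_⟩
        have : y ∈ T.filter (fun t => t < x) := Finset.mem_filter.2 ⟨hy, hyx⟩
        rw [he] at this
        simp at this
      · obtain ⟨q, hq, hqmax⟩ := Finset.exists_max_image _ id hne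
        simp only [id] at hqmax
        have hq' := Finset.mem_filter.1 hq
        have hstep := tri_step (T.erase x) S m q hm hmax
          (Finset.mem_erase.2 ⟨by omega, hq'.1⟩) (by omega) (by
            intro t ht htm
            rw [Finset.mem_erase] at ht
            have := hpmax t ht.2 htm
            exact hqmax t (Finset.mem_filter.2 ⟨ht.2, by omega⟩))
        have hf : (T.erase x).filter (fun t => t < q) = (T.filter (fun t => t < x)).erase q := by
          ext t
          simp only [Finset.mem_filter, Finset.mem_erase]
          constructor
          · rintro ⟨⟨h1, h2⟩, h3⟩
            exact ⟨by omega, h2, by omega⟩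
          · rintro ⟨h1, h2, h3⟩
            have := hqmax t (Finset.mem_filter.2 ⟨h2, h3⟩)
            exact ⟨⟨by omega, h2⟩, by omega⟩
        rw [hstep, hf]
        by_cases hqt : q ∈ tri (T.filter (fun t => t < x)) (S.erase m)
        · obtain ⟨i1, i2⟩ := ih _ _ _ hc' hqt
          constructor
          · intro hall
            rw [i1, Finset.insert_erase hqt]
            intro t ht htq
            have := hall t (Finset.mem_filter.1 ht).1 (by omega)
            rw [Finset.mem_insert] at this
            rcases this with h | h
            · omega
            · exact h
          · intro y hy hyx hyn hymax
            rw [Finset.mem_insert, not_or] at hyn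
            have hyf : y ∈ T.filter (fun t => t < x) := Finset.mem_filter.2 ⟨hy, hyx⟩
            have hyq := hqmax y hyf
            have hne : y ≠ q := fun h => hyn.2 (h ▸ hqt)
            rw [i2 y hyf (by omega) hyn.2, Finset.insert_comm, Finset.insert_erase hqt]
            intro t ht htq htn
            apply hymax t (Finset.mem_filter.1 ht).1 (by omega)
            rw [Finset.mem_insert, not_or]
            exact ⟨by omega, htn⟩
        · rw [tri_erase_not_mem n _ _ _ hc' hqt]
          have hqn : q ∉ insert x (tri (T.filter (fun t => t < x)) (S.erase m)) := by
            rw [Finset.mem_insert, not_or]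
            exact ⟨by omega, hqt⟩
          constructor
          · intro hall
            exact absurd (hall q hq'.1 hq'.2) hqn
          · intro y hy hyx hyn hymax
            have h1 := hymax q hq'.1 hq'.2 hqn
            have h2 := hqmax y (Finset.mem_filter.2 ⟨hy, hyx⟩)
            rw [le_antisymm h1 h2]
    · have hx' : x ∈ tri (T.filter (fun t => t < p)) (S.erase m) :=
        (Finset.mem_insert.1 hx).resolve_left hxp
      have hxlt := hlt x hx'
      obtain ⟨i1, i2⟩ := ih _ _ _ hc' hx'
      rw [tri_step (T.erase x) S m p hm hmax (Finset.mem_erase.2 ⟨Ne.symm hxp, hp⟩) hpm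
        (fun t ht => hpmax t (Finset.mem_of_mem_erase ht)), Finset.filter_erase,
        Finset.erase_insert_of_ne (Ne.symm hxp)]
      constructor
      · intro hall
        rw [i1]
        intro t ht htx
        have := hall t (Finset.mem_filter.1 ht).1 htx
        rw [Finset.mem_insert] at this
        rcases this with h | h
        · omega
        · exact h
      · intro y hy hyx hyn hymax
        rw [Finset.mem_insert, not_or] at hyn
        rw [i2 y (Finset.mem_filter.2 ⟨hy, by omega⟩) hyx hyn.2, Finset.insert_comm]
        intro t ht htx htn
        apply hymax t (Finset.mem_filter.1 ht).1 htx
        rw [Finset.mem_insert, not_or]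
        exact ⟨by omega, htn⟩

theorem stmt2 (S T : Finset ℕ) (hSpos : ∀ a ∈ S, 0 < a) (hTpos : ∀ a ∈ T, 0 < a)
    (x : ℕ) (hx : x ∈ tri T S) :
    (T.filter (· < x) \ tri T S = ∅ → tri (T.erase x) S = (tri T S).erase x) ∧
    (∀ h : (T.filter (· < x) \ tri T S).Nonempty,
      tri (T.erase x) S =
        insert ((T.filter (· < x) \ tri T S).max' h) ((tri T S).erase x)) := by
  obtain ⟨i1, i2⟩ := tri_main S.card S T x rfl hx
  constructor
  · intro he
    apply i1
    intro t ht htx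
    by_contra hn
    have : t ∈ T.filter (· < x) \ tri T S :=
      Finset.mem_sdiff.2 ⟨Finset.mem_filter.2 ⟨ht, htx⟩, hn⟩
    rw [he] at this
    simp at this
  · intro h
    have hy := Finset.mem_sdiff.1 (Finset.max'_mem _ h)
    have hy1 := Finset.mem_filter.1 hy.1
    apply i2 _ hy1.1 hy1.2 hy.2
    intro t ht htx hn
    exact Finset.le_max' _ _ (Finset.mem_sdiff.2 ⟨Finset.mem_filter.2 ⟨ht, htx⟩, hn⟩)
end

section
/- Let S and T be finite sets of positive integers with T ⪯ S. Then T ◁ S ⪯ S. -/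
theorem nth_eq_natNth (S : Finset ℕ) (i : ℕ) : nth S i = Nat.nth (· ∈ S) (i - 1) := by
  have hf : (Set.ofPred (· ∈ S)).Finite := S.finite_toSet
  rw [Nat.nth_eq_getD_sort hf]
  have : hf.toFinset = S := by ext; rw [Set.Finite.mem_toFinset]; rfl
  rw [this]; rfl

theorem natNth_mem (S : Finset ℕ) (j : ℕ) (hj : j < S.card) :
    Nat.nth (· ∈ S) j ∈ S ∧ Nat.count (· ∈ S) (Nat.nth (· ∈ S) j) = j := by
  have key : ∀ hf : (Set.ofPred (· ∈ S)).Finite, j < hf.toFinset.card := by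
    intro hf
    have : hf.toFinset = S := by ext; rw [Set.Finite.mem_toFinset]; rfl
    rwa [this]
  exact ⟨Nat.nth_mem (p := (· ∈ S)) j key, Nat.count_nth (p := (· ∈ S)) key⟩

theorem count_eq (S : Finset ℕ) (x : ℕ) :
    Nat.count (· ∈ S) x = (S.filter (· < x)).card := by
  rw [Nat.count_eq_card_filter_range]
  congr 1; ext a; simp [and_comm]

theorem dom_iff (S T : Finset ℕ) :
    Dom T S ↔ ∀ s ∈ S, (S.filter (· < s)).card < (T.filter (· < s)).card := by
  constructor
  · rintro ⟨hc, h⟩ s hs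
    have hlt : (S.filter (· < s)).card < S.card :=
      Finset.card_lt_card (Finset.filter_ssubset.2 ⟨s, hs, by simp⟩)
    have h1 := h ((S.filter (· < s)).card + 1) (by omega) (by omega)
    rw [nth_eq_natNth, nth_eq_natNth, Nat.add_sub_cancel] at h1
    rw [← count_eq S s, Nat.nth_count (p := (· ∈ S)) hs, count_eq] at h1
    obtain ⟨hm, hcm⟩ := natNth_mem T (S.filter (· < s)).card (by omega)
    rw [count_eq] at hcm
    rw [← hcm]
    apply Finset.card_lt_card
    refine ⟨fun a ha => ?_, fun hsub => ?_⟩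
    · simp only [Finset.mem_filter] at ha ⊢
      exact ⟨ha.1, by omega⟩
    · have := hsub (Finset.mem_filter.2 ⟨hm, h1⟩)
      simp at this
  · intro h
    have hc : S.card ≤ T.card := by
      rcases S.eq_empty_or_nonempty with rfl | hS
      · simp
      · have h1 := h _ (S.max'_mem hS)
        have h2 : S.filter (· < S.max' hS) = S.erase (S.max' hS) := by
          ext a
          simp only [Finset.mem_filter, Finset.mem_erase]
          constructor
          · rintro ⟨h3, h4⟩; exact ⟨by omega, h3⟩
          · rintro ⟨h3, h4⟩; exact ⟨h4, lt_of_le_of_ne (S.le_max' a h4) h3⟩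
        rw [h2, Finset.card_erase_of_mem (S.max'_mem hS)] at h1
        have := Finset.card_filter_le T (· < S.max' hS)
        omega
    refine ⟨hc, fun i h1 h2 => ?_⟩
    rw [nth_eq_natNth, nth_eq_natNth]
    obtain ⟨hm, hcm⟩ := natNth_mem S (i - 1) (by omega)
    obtain ⟨hm', hcm'⟩ := natNth_mem T (i - 1) (by omega)
    have h3 := h _ hm
    rw [count_eq] at hcm hcm'
    rw [hcm] at h3
    by_contra hlt
    push Not at hlt
    have : (T.filter (· < Nat.nth (· ∈ S) (i-1))).card ≤
        (T.filter (· < Nat.nth (· ∈ T) (i-1))).card := by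
      apply Finset.card_le_card
      intro a ha
      simp only [Finset.mem_filter] at ha ⊢
      exact ⟨ha.1, by omega⟩
    omega

theorem tri_dom (n : ℕ) : ∀ (S T : Finset ℕ), S.card = n →
    (∀ s ∈ S, (S.filter (· < s)).card < (T.filter (· < s)).card) →
    (S.card ≤ (tri T S).card ∧
      ∀ s ∈ S, (S.filter (· < s)).card < ((tri T S).filter (· < s)).card) := by
  induction n with
  | zero =>
    intro S T h
    rw [Finset.card_eq_zero] at h
    subst h
    simp
  | succ n ih =>
    intro S T h hd
    have hS : S.Nonempty := by rw [← Finset.card_pos]; omega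
    have hsm := S.max'_mem hS
    have hT : (T.filter (fun t => t < S.max' hS)).Nonempty := by
      rw [← Finset.card_pos]; have := hd _ hsm; omega
    have htm := Finset.max'_mem _ hT
    have hle := Finset.le_max' (T.filter (fun t => t < S.max' hS))
    have hsle := S.le_max'
    rw [tri, dif_pos hS, dif_pos hT]
    generalize hm : (T.filter (fun t => t < S.max' hS)).max' hT = m at *
    have hle' : ∀ a ∈ T, a < S.max' hS → a ≤ m := fun a h1 h2 => by
      rw [← hm]; exact hle a (Finset.mem_filter.2 ⟨h1, h2⟩)
    have hsle' : ∀ a ∈ S, a ≤ S.max' hS := fun a h1 => hsle a h1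
    clear hle hsle hm
    generalize S.max' hS = s at *
    obtain ⟨hmT, hms⟩ := Finset.mem_filter.1 htm
    have hcard : (S.erase s).card = n := by
      rw [Finset.card_erase_of_mem hsm]; omega
    have hSs : S.filter (· < s) = S.erase s := by
      ext a
      simp only [Finset.mem_filter, Finset.mem_erase]
      constructor
      · rintro ⟨h3, h4⟩; exact ⟨by omega, h3⟩
      · rintro ⟨h3, h4⟩; exact ⟨h4, lt_of_le_of_ne (hsle' a h4) h3⟩
    have hSa : ∀ a ∈ S, (S.erase s).filter (· < a) = S.filter (· < a) := by
      intro a ha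
      ext b
      have := hsle' a ha
      simp only [Finset.mem_filter, Finset.mem_erase]
      constructor
      · rintro ⟨⟨_, h3⟩, h4⟩; exact ⟨h3, h4⟩
      · rintro ⟨h3, h4⟩; exact ⟨⟨by omega, h3⟩, h4⟩
    have hTs : T.filter (· < s) = insert m (T.filter (· < m)) := by
      ext a
      simp only [Finset.mem_filter, Finset.mem_insert]
      constructor
      · rintro ⟨h3, h4⟩
        have := hle' a h3 h4
        rcases this.eq_or_lt with h5 | h5
        · exact Or.inl h5
        · exact Or.inr ⟨h3, h5⟩
      · rintro (rfl | ⟨h3, h4⟩)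
        · exact ⟨hmT, hms⟩
        · exact ⟨h3, by omega⟩
    have hTc : (T.filter (· < s)).card = (T.filter (· < m)).card + 1 := by
      rw [hTs, Finset.card_insert_of_notMem (by simp)]
    have hds := hd s hsm
    rw [hSs, hcard, hTc] at hds
    obtain ⟨ih1, ih2⟩ := ih (S.erase s) (T.filter (· < m)) hcard (by
      intro a ha
      have haS := Finset.mem_of_mem_erase ha
      rw [hSa a haS]
      rcases le_or_gt a m with ham | ham
      · have : (T.filter (· < m)).filter (· < a) = T.filter (· < a) := by
          ext b
          simp only [Finset.mem_filter]
          constructor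
          · rintro ⟨⟨h3, _⟩, h4⟩; exact ⟨h3, h4⟩
          · rintro ⟨h3, h4⟩; exact ⟨⟨h3, by omega⟩, h4⟩
        rw [this]; exact hd a haS
      · have : (T.filter (· < m)).filter (· < a) = T.filter (· < m) := by
          apply Finset.filter_true_of_mem
          intro b hb
          have := (Finset.mem_filter.1 hb).2
          omega
        rw [this]
        have h5 : (S.filter (· < a)).card < (S.erase s).card := by
          rw [← hSa a haS]
          exact Finset.card_lt_card (Finset.filter_ssubset.2 ⟨a, ha, by simp⟩)
        omega)
    have hsub := tri_subset n (S.erase s) (T.filter (· < m)) hcard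
    generalize tri (T.filter (· < m)) (S.erase s) = U at *
    have hmU : m ∉ U := fun hc => by simpa using hsub hc
    have hUm : ∀ b ∈ U, b < m := fun b hb => (Finset.mem_filter.1 (hsub hb)).2
    have hc1 : (insert m U).card = U.card + 1 := Finset.card_insert_of_notMem hmU
    refine ⟨by omega, fun a ha => ?_⟩
    rcases eq_or_ne a s with rfl | hne
    · rw [hSs, Finset.filter_true_of_mem]
      · omega
      · intro b hb
        rcases Finset.mem_insert.1 hb with rfl | hb
        · exact hms
        · have := hUm b hb
          omega
    · have h6 := ih2 a (Finset.mem_erase.2 ⟨hne, ha⟩)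
      rw [hSa a ha] at h6
      exact h6.trans_le (Finset.card_le_card
        (Finset.filter_subset_filter _ (Finset.subset_insert _ _)))

theorem stmt4 (S T : Finset ℕ) (hSpos : ∀ a ∈ S, 0 < a) (hTpos : ∀ a ∈ T, 0 < a)
    (hd : Dom T S) : Dom (tri T S) S := by
  rw [dom_iff] at hd ⊢
  exact (tri_dom _ S T rfl hd).2
end

section
/- Let S and T be finite sets of positive integers and let x ∈ T be such that T_{≥x+1} ⪯ S_{>x+1} and x + 1 ∉ S. Then x ∉ T ◁ S. -/
theorem nth_eq_orderEmb (S : Finset ℕ) (i : Fin S.card) :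
    nth S (i.1 + 1) = S.orderEmbOfFin rfl i := by
  have hl : i.1 < (S.sort (· ≤ ·)).length := by simp
  rw [Finset.orderEmbOfFin_apply]
  simp [nth, List.getD_eq_getElem, hl]

theorem dom_count (S T : Finset ℕ) (hd : Dom T S) (y : ℕ) :
    (S.filter (fun s => s ≤ y)).card ≤ (T.filter (fun t => t < y)).card := by
  obtain ⟨hc, hd⟩ := hd
  have h1 : (S.filter (fun s => s ≤ y)).card ≤
      (Finset.univ.filter (fun i : Fin S.card => S.orderEmbOfFin rfl i ≤ y)).card := by
    refine le_trans (Finset.card_le_card ?_)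
      (Finset.card_image_le (f := fun i => S.orderEmbOfFin rfl i))
    intro a ha
    rw [Finset.mem_filter] at ha
    have : a ∈ Set.range (S.orderEmbOfFin rfl) := by
      rw [Finset.range_orderEmbOfFin]; exact ha.1
    obtain ⟨i, rfl⟩ := this
    exact Finset.mem_image.2 ⟨i, by simpa using ha.2, rfl⟩
  refine h1.trans (Finset.card_le_card_of_injOn
    (fun i => T.orderEmbOfFin rfl (Fin.castLE hc i)) ?_ ?_)
  · intro i hi
    have hi' : S.orderEmbOfFin rfl i ≤ y := by simpa using hi
    have h := hd (i.1 + 1) (by omega) (by have := i.2; omega)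
    rw [nth_eq_orderEmb S i] at h
    have h2 := nth_eq_orderEmb T (Fin.castLE hc i)
    simp only [Fin.val_castLE] at h2
    rw [h2] at h
    simp only [Finset.coe_filter, Set.mem_setOf_eq]
    exact ⟨Finset.orderEmbOfFin_mem _ _ _, by omega⟩
  · intro i _ j _ hij
    have := (T.orderEmbOfFin rfl).injective hij
    exact Fin.castLE_injective hc this

theorem not_mem_tri_of_count (x n : ℕ) : ∀ (S T : Finset ℕ), S.card = n → x + 1 ∉ S →
    (∀ y, (S.filter (fun s => x + 1 < s ∧ s ≤ y)).card ≤
      (T.filter (fun t => x + 1 ≤ t ∧ t < y)).card) → x ∉ tri T S := by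
  induction n with
  | zero =>
    intro S T h _ _
    rw [tri, dif_neg (by simp [Finset.card_eq_zero.1 h])]
    simp
  | succ n ih =>
    intro S T h hx hC
    rw [tri]
    split_ifs with hS hT
    · have hcard : (S.erase (S.max' hS)).card = n := by
        rw [Finset.card_erase_of_mem (S.max'_mem hS), h]; rfl
      have hsS := S.max'_mem hS
      have hsmax : ∀ a ∈ S, a ≤ S.max' hS := fun a ha => S.le_max' a ha
      have hmm := Finset.max'_mem _ hT
      have hmmax : ∀ a ∈ T.filter (fun t => t < S.max' hS),
          a ≤ (T.filter (fun t => t < S.max' hS)).max' hT := fun a ha => Finset.le_max' _ a ha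
      generalize (T.filter (fun t => t < S.max' hS)).max' hT = m at *
      generalize S.max' hS = s at *
      rw [Finset.mem_filter] at hmm
      have hsx : s ≠ x + 1 := fun e => hx (e ▸ hsS)
      rw [Finset.mem_insert]
      rintro (hxm | hxt)
      · by_cases hs : x + 1 < s
        · have h1 : 0 < (S.filter (fun a => x + 1 < a ∧ a ≤ s)).card :=
            Finset.card_pos.2 ⟨s, by simp [hsS, hs]⟩
          obtain ⟨t, ht⟩ := Finset.card_pos.1 (h1.trans_le (hC s))
          rw [Finset.mem_filter] at ht
          have := hmmax t (by simp [ht])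
          omega
        · omega
      · have hxT' := tri_subset n _ _ hcard hxt
        rw [Finset.mem_filter] at hxT'
        have hs : x + 1 < s := by omega
        refine ih _ _ hcard (fun e => hx (Finset.mem_of_mem_erase e)) ?_ hxt
        intro y
        by_cases hy : y ≤ m
        · refine le_trans (Finset.card_le_card ?_) ((hC y).trans (Finset.card_le_card ?_))
          · exact Finset.filter_subset_filter _ (Finset.erase_subset _ _)
          · intro a ha
            simp only [Finset.mem_filter] at ha ⊢
            exact ⟨⟨ha.1, by omega⟩, ha.2⟩
        · have h1 : ((S.erase s).filter (fun a => x + 1 < a ∧ a ≤ y)).card + 1 ≤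
              (S.filter (fun a => x + 1 < a ∧ a ≤ s)).card := by
            rw [← Finset.card_insert_of_notMem (a := s) (by simp)]
            apply Finset.card_le_card
            intro a ha
            simp only [Finset.mem_filter, Finset.mem_insert, Finset.mem_erase] at ha ⊢
            rcases ha with rfl | ha
            · exact ⟨hsS, hs, le_rfl⟩
            · exact ⟨ha.1.2, ha.2.1, hsmax _ ha.1.2⟩
          have h2 : (T.filter (fun a => x + 1 ≤ a ∧ a < s)).card ≤
              ((T.filter (fun t => t < m)).filter (fun a => x + 1 ≤ a ∧ a < y)).card + 1 := by
            refine le_trans (Finset.card_le_card ?_) (Finset.card_insert_le m _)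
            intro a ha
            simp only [Finset.mem_filter, Finset.mem_insert] at ha ⊢
            have := hmmax a (by simp [ha])
            by_cases e : a = m
            · exact Or.inl e
            · exact Or.inr ⟨⟨ha.1, by omega⟩, by omega, by omega⟩
          have := hC s
          omega
    · simp
    · simp

theorem stmt9 (S T : Finset ℕ) (hSpos : ∀ a ∈ S, 0 < a) (hTpos : ∀ a ∈ T, 0 < a)
    (x : ℕ) (hxT : x ∈ T)
    (hd : Dom (T.filter (fun t => x + 1 ≤ t)) (S.filter (fun s => x + 1 < s)))
    (hxS : x + 1 ∉ S) :
    x ∉ tri T S := by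
  refine not_mem_tri_of_count x _ S T rfl hxS fun y => ?_
  have h := dom_count _ _ hd y
  rwa [Finset.filter_filter, Finset.filter_filter] at h
end

section
/- Let S and T be finite sets of positive integers with T ⪯ S, and let S' be a proper subset of S. Set a = min(S \ S'). Then (T ◁ S) \ (T ◁ S') is nonempty, and setting b = min((T ◁ S) \ (T ◁ S')), one has T ◁ (S − a) = (T ◁ S) − b. -/
/-- Queue description of the greedy picking procedure. -/
def gq (T S : Finset ℕ) : ℕ → ℕ → Finset ℕ
  | 0, _ => ∅
  | N + 1, q => (if N ∈ T ∧ 0 < q then {N} else ∅) ∪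
      gq T S N ((if N ∈ T then q - 1 else q) + (if N ∈ S then 1 else 0))

theorem gq_lt (T S : Finset ℕ) : ∀ N q x, x ∈ gq T S N q → x < N
  | 0, q, x, h => by simp [gq] at h
  | N + 1, q, x, h => by
    rw [gq, Finset.mem_union] at h
    rcases h with h | h
    · split_ifs at h <;> simp_all
    · have := gq_lt T S N _ x h
      omega

theorem gq_congr (T S S' : Finset ℕ) : ∀ N q, (∀ x < N, (x ∈ S ↔ x ∈ S')) →
    gq T S N q = gq T S' N q
  | 0, q, h => rfl
  | N + 1, q, h => by
    have h1 := h N (by omega)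
    rw [gq, gq, gq_congr T S S' N _ (fun x hx => h x (by omega))]
    simp only [h1]

theorem tri_eq (T S : Finset ℕ) (m : ℕ) (hm : m ∈ S) (hmax : ∀ s ∈ S, s ≤ m)
    (p : ℕ) (hp : p ∈ T) (hpm : p < m) (hpmax : ∀ t ∈ T, t < m → t ≤ p) :
    tri T S = insert p (tri (T.filter (· < p)) (S.erase m)) := by
  have hS : S.Nonempty := ⟨m, hm⟩
  have e : S.max' hS = m := le_antisymm (Finset.max'_le _ _ _ hmax) (Finset.le_max' _ _ hm)
  have hT : (T.filter (fun t => t < S.max' hS)).Nonempty :=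
    ⟨p, by rw [Finset.mem_filter, e]; exact ⟨hp, hpm⟩⟩
  have e2 : (T.filter (fun t => t < S.max' hS)).max' hT = p := by
    apply le_antisymm
    · apply Finset.max'_le
      intro y hy
      rw [Finset.mem_filter, e] at hy
      exact hpmax y hy.1 hy.2
    · apply Finset.le_max'
      rw [Finset.mem_filter, e]; exact ⟨hp, hpm⟩
  rw [tri, dif_pos hS, dif_pos hT, e2, e]

theorem tri_empty (T S : Finset ℕ) (h : ∀ s ∈ S, ∀ t ∈ T, ¬ t < s) : tri T S = ∅ := by
  rw [tri]
  split_ifs with hS hT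
  · exfalso
    obtain ⟨t, ht⟩ := hT
    rw [Finset.mem_filter] at ht
    exact h _ (S.max'_mem hS) t ht.1 ht.2
  · rfl
  · rfl

theorem tri_congr (T T' S : Finset ℕ) (h : ∀ s ∈ S, ∀ t < s, (t ∈ T ↔ t ∈ T')) :
    tri T S = tri T' S := by
  by_cases hS : S.Nonempty
  · have hm := S.max'_mem hS
    have hmax := S.le_max'
    generalize hh : S.max' hS = m at *
    have hmax : ∀ s ∈ S, s ≤ m := fun s hs => hh ▸ S.le_max' s hs
    by_cases hT : (T.filter (fun t => t < m)).Nonempty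
    · have hp := Finset.max'_mem _ hT
      have hpmax : ∀ t ∈ T.filter (fun t => t < m),
          t ≤ (T.filter (fun t => t < m)).max' hT :=
        fun t ht => Finset.le_max' (T.filter (fun t => t < m)) t ht
      generalize (T.filter (fun t => t < m)).max' hT = p at hp hpmax
      simp only [Finset.mem_filter] at hp hpmax
      rw [tri_eq T S m hm hmax p hp.1 hp.2 (fun t h1 h2 => hpmax t ⟨h1, h2⟩),
        tri_eq T' S m hm hmax p ((h m hm p hp.2).1 hp.1) hp.2
          (fun t h1 h2 => hpmax t ⟨(h m hm t h2).2 h1, h2⟩)]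
      congr 2
      ext t
      simp only [Finset.mem_filter]
      constructor
      · rintro ⟨h1, h2⟩
        exact ⟨(h m hm t (by omega)).1 h1, h2⟩
      · rintro ⟨h1, h2⟩
        exact ⟨(h m hm t (by omega)).2 h1, h2⟩
    · have hT' : ∀ t ∈ T, ¬ t < m := fun t h1 h2 => hT ⟨t, by simp [h1, h2]⟩
      rw [tri_empty T S, tri_empty T' S]
      · intro s hs t ht hts
        have := hmax s hs
        exact hT' t ((h s hs t hts).2 ht) (by omega)
      · intro s hs t ht hts
        have := hmax s hs
        exact hT' t ht (by omega)
  · rw [Finset.not_nonempty_iff_eq_empty] at hS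
    subst hS
    rw [tri_empty, tri_empty] <;> simp

theorem filter_ge_succ (S : Finset ℕ) (N : ℕ) :
    (S.filter (N ≤ ·)).card = (S.filter (N + 1 ≤ ·)).card + if N ∈ S then 1 else 0 := by
  split_ifs with h
  · rw [← Finset.card_insert_of_notMem (a := N) (by simp)]
    congr 1
    ext x
    simp only [Finset.mem_filter, Finset.mem_insert]
    grind
  · congr 1
    ext x
    simp only [Finset.mem_filter]
    grind

theorem filter_lt_succ (S : Finset ℕ) (N : ℕ) :
    (S.filter (· < N + 1)).card = (S.filter (· < N)).card + if N ∈ S then 1 else 0 := by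
  split_ifs with h
  · rw [← Finset.card_insert_of_notMem (a := N) (by simp)]
    congr 1
    ext x
    simp only [Finset.mem_filter, Finset.mem_insert]
    grind
  · congr 1
    ext x
    simp only [Finset.mem_filter]
    grind

theorem tri_gq (T : Finset ℕ) : ∀ N (S : Finset ℕ),
    tri (T.filter (· < N)) S = gq T S N (S.filter (N ≤ ·)).card
  | 0, S => by
    rw [gq, tri_empty]
    simp
  | N + 1, S => by
    have hc := filter_ge_succ S N
    rw [gq]
    by_cases hN : N ∈ T
    · by_cases hq : 0 < (S.filter (N + 1 ≤ ·)).card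
      · rw [if_pos ⟨hN, hq⟩, if_pos hN]
        obtain ⟨s, hs⟩ := Finset.card_pos.1 hq
        rw [Finset.mem_filter] at hs
        have hS : S.Nonempty := ⟨s, hs.1⟩
        have hm := S.max'_mem hS
        have hmax := S.le_max'
        generalize hh : S.max' hS = m at *
        have hmax : ∀ s ∈ S, s ≤ m := fun s hs => hh ▸ S.le_max' s hs
        have hsm := hmax s hs.1
        rw [tri_eq _ S m hm hmax N (by simp [hN]) (by omega) (by
          intro t ht _
          simp only [Finset.mem_filter] at ht
          omega)]
        have e : (T.filter (· < N + 1)).filter (· < N) = T.filter (· < N) := by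
          ext x
          simp only [Finset.mem_filter]
          grind
        have e2 : ((S.erase m).filter (N ≤ ·)).card + 1 = (S.filter (N ≤ ·)).card := by
          rw [← Finset.card_insert_of_notMem (a := m) (by simp)]
          congr 1
          ext x
          simp only [Finset.mem_filter, Finset.mem_insert, Finset.mem_erase]
          grind
        rw [e, tri_gq T N (S.erase m), gq_congr T (S.erase m) S N]
        · rw [Finset.insert_eq]
          congr 2
          omega
        · intro x hx
          simp only [Finset.mem_erase]
          grind
      · rw [if_neg (by tauto), if_pos hN, Finset.empty_union]
        have e : (S.filter (N + 1 ≤ ·)).card - 1 + (if N ∈ S then 1 else 0) =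
          (S.filter (N ≤ ·)).card := by omega
        rw [e, ← tri_gq T N S]
        apply tri_congr
        intro s hs t ht
        have : s ≤ N := by
          by_contra hcon
          exact hq (Finset.card_pos.2 ⟨s, by simp only [Finset.mem_filter]; exact ⟨hs, by omega⟩⟩)
        simp only [Finset.mem_filter]
        grind
    · rw [if_neg (by tauto), if_neg hN, Finset.empty_union, ← hc, ← tri_gq T N S]
      congr 1
      ext x
      simp only [Finset.mem_filter]
      grind

/-- Hall-type consequence of domination. -/
theorem hall_of_dom (T S : Finset ℕ) (hd : Dom T S) (x : ℕ) :
    (S.filter (· < x + 1)).card ≤ (T.filter (· < x)).card := by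
  obtain ⟨hc, hd⟩ := hd
  rcases Nat.eq_zero_or_pos (S.filter (· < x + 1)).card with h0 | h0
  · omega
  have hk : (S.filter (· < x + 1)).card ≤ S.card := Finset.card_filter_le _ _
  generalize hkk : (S.filter (· < x + 1)).card = k at *
  have hlt := hd k h0 hk
  have key : ∀ (U : Finset ℕ) (hU : k ≤ U.card),
      nth U k = U.orderEmbOfFin rfl ⟨k - 1, by omega⟩ := by
    intro U hU
    rw [nth, Finset.orderEmbOfFin_apply, List.getD_eq_getElem _ _
      (by rw [Finset.length_sort]; omega)]
    rfl
  rw [key S hk, key T (by omega)] at hlt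
  have h1 : S.orderEmbOfFin rfl ⟨k - 1, by omega⟩ ≤ x := by
    by_contra hcon
    have hsub : S.filter (· < x + 1) ⊆
        (Finset.Iio (⟨k - 1, by omega⟩ : Fin S.card)).image (S.orderEmbOfFin rfl) := by
      intro y hy
      rw [Finset.mem_filter] at hy
      have : y ∈ Set.range (S.orderEmbOfFin rfl) := by
        rw [Finset.range_orderEmbOfFin]; exact hy.1
      obtain ⟨i, rfl⟩ := this
      refine Finset.mem_image_of_mem _ ?_
      rw [Finset.mem_Iio, ← (S.orderEmbOfFin rfl).lt_iff_lt]
      omega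
    have := (Finset.card_le_card hsub).trans Finset.card_image_le
    rw [Fin.card_Iio] at this
    simp only at this
    omega
  have hsub : (Finset.Iic (⟨k - 1, by omega⟩ : Fin T.card)).image (T.orderEmbOfFin rfl) ⊆
      T.filter (· < x) := by
    intro y hy
    obtain ⟨i, hi, rfl⟩ := Finset.mem_image.1 hy
    rw [Finset.mem_Iic, ← (T.orderEmbOfFin rfl).le_iff_le] at hi
    rw [Finset.mem_filter]
    exact ⟨Finset.orderEmbOfFin_mem _ _ _, by omega⟩
  have := Finset.card_le_card hsub
  rw [Finset.card_image_of_injective _ (T.orderEmbOfFin rfl).injective, Fin.card_Iic] at this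
  simp only at this
  omega

/-- The conclusion for three sets `X = T ◁ S`, `Y = T ◁ S'`, `Z = T ◁ (S - a)`. -/
def Concl (X Y Z : Finset ℕ) : Prop :=
  ∃ b ∈ X, b ∉ Y ∧ (∀ c ∈ X, c < b → c ∈ Y) ∧ Z = X.erase b

theorem concl_insert (X Y Z : Finset ℕ) (N : ℕ) (hX : ∀ x ∈ X, x < N) (h : Concl X Y Z) :
    Concl ({N} ∪ X) ({N} ∪ Y) ({N} ∪ Z) ∧ Concl ({N} ∪ X) Y ({N} ∪ Z) := by
  obtain ⟨b, hb, hbY, hc, rfl⟩ := h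
  have hbN := hX b hb
  have e : {N} ∪ X.erase b = ({N} ∪ X).erase b := by
    ext y
    simp only [Finset.mem_union, Finset.mem_singleton, Finset.mem_erase]
    grind
  refine ⟨⟨b, ?_, ?_, ?_, e⟩, ⟨b, ?_, ?_, ?_, e⟩⟩ <;>
    (try simp only [Finset.mem_union, Finset.mem_singleton]) <;> grind

theorem phase2 (T S S' : Finset ℕ) (a : ℕ)
    (hH : ∀ x, (S.filter (· < x + 1)).card ≤ (T.filter (· < x)).card)
    (hag : ∀ x < a, (x ∈ S ↔ x ∈ S')) : ∀ N q r, N ≤ a → r < q →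
    q + (S.filter (· < N)).card ≤ (T.filter (· < N)).card →
    Concl (gq T S N q) (gq T S' N r) (gq T (S.erase a) N (q - 1))
  | 0, q, r, hN, hr, hJ => by
    simp at hJ; omega
  | N + 1, q, r, hN, hr, hJ => by
    have hs := hag N (by omega)
    have hs2 : N ∈ S.erase a ↔ N ∈ S := by
      simp only [Finset.mem_erase]
      grind
    have c1 := filter_lt_succ S N
    have c2 := filter_lt_succ T N
    have hHN := hH N
    simp only [gq, hs2, ← hs]
    generalize (if N ∈ S then 1 else 0) = e at *
    by_cases hT : N ∈ T
    · simp only [hT, true_and, if_true] at c2 ⊢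
      rw [if_pos (by omega : 0 < q)]
      by_cases hq : q = 1
      · subst hq
        obtain rfl : r = 0 := by omega
        simp only [Nat.sub_self, Nat.zero_sub, lt_irrefl, if_false, Finset.empty_union, zero_add]
        rw [gq_congr T S' S N e (fun x hx => (hag x (by omega)).symm),
          gq_congr T (S.erase a) S N e (fun x hx => by simp only [Finset.mem_erase]; grind)]
        have hl := gq_lt T S N e
        refine ⟨N, by simp, fun h => by simpa using hl _ h, ?_, ?_⟩
        · intro c hc hcN
          simp only [Finset.mem_union, Finset.mem_singleton] at hc
          grind
        · ext y
          simp only [Finset.mem_union, Finset.mem_singleton, Finset.mem_erase]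
          grind
      · have ih := phase2 T S S' a hH hag N (q - 1 + e) (r - 1 + e) (by omega) (by omega) (by omega)
        have e1 : q - 1 + e - 1 = q - 1 - 1 + e := by omega
        rw [e1] at ih
        have := concl_insert _ _ _ N (gq_lt T S N _) ih
        rw [if_pos (by omega : 0 < q - 1)]
        split_ifs
        · exact this.1
        · rw [Finset.empty_union]; exact this.2
    · simp only [hT, false_and, if_false, Finset.empty_union] at c2 ⊢
      have ih := phase2 T S S' a hH hag N (q + e) (r + e) (by omega) (by omega) (by omega)
      have e1 : q + e - 1 = q - 1 + e := by omega
      rwa [e1] at ih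

theorem phase1 (T S S' : Finset ℕ) (a : ℕ) (haS : a ∈ S) (haS' : a ∉ S') (hsub : S' ⊆ S)
    (hH : ∀ x, (S.filter (· < x + 1)).card ≤ (T.filter (· < x)).card)
    (hag : ∀ x < a, (x ∈ S ↔ x ∈ S')) : ∀ N q r, a < N → r ≤ q →
    q + (S.filter (· < N)).card ≤ (T.filter (· < N)).card →
    Concl (gq T S N q) (gq T S' N r) (gq T (S.erase a) N q)
  | 0, q, r, hN, hr, hJ => by omega
  | N + 1, q, r, hN, hr, hJ => by
    have c1 := filter_lt_succ S N
    have c2 := filter_lt_succ T N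
    have hHN := hH N
    have ih : Concl
        (gq T S N ((if N ∈ T then q - 1 else q) + (if N ∈ S then 1 else 0)))
        (gq T S' N ((if N ∈ T then r - 1 else r) + (if N ∈ S' then 1 else 0)))
        (gq T (S.erase a) N ((if N ∈ T then q - 1 else q) +
          (if N ∈ S.erase a then 1 else 0))) := by
      by_cases hNa : N = a
      · subst hNa
        simp only [haS, haS', Finset.notMem_erase, if_true, if_false] at c1 ⊢
        apply phase2 T S S' N hH hag N _ _ le_rfl
        · split_ifs <;> omega
        · split_ifs at * <;> omega
      · have hs2 : N ∈ S.erase a ↔ N ∈ S := by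
          simp only [Finset.mem_erase]
          grind
        have hs3 := @hsub N
        simp only [hs2]
        apply phase1 T S S' a haS haS' hsub hH hag N _ _ (by omega)
        · by_cases h1 : N ∈ S'
          · have := hs3 h1
            split_ifs <;> omega
          · split_ifs <;> omega
        · split_ifs at * <;> omega
    have := concl_insert _ _ _ N (gq_lt T S N _) ih
    simp only [gq]
    by_cases hT : N ∈ T
    · simp only [hT, true_and, if_true] at this ih ⊢
      by_cases hq : 0 < q
      · rw [if_pos hq]
        by_cases hr0 : 0 < r
        · rw [if_pos hr0]; exact this.1
        · rw [if_neg hr0, Finset.empty_union]; exact this.2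
      · rw [if_neg hq, if_neg (by omega : ¬ 0 < r)]
        simpa only [Finset.empty_union] using ih
    · simp only [hT, false_and, if_false, Finset.empty_union] at ih ⊢
      exact ih

theorem stmt11 (S S' T : Finset ℕ) (hSpos : ∀ a ∈ S, 0 < a) (hTpos : ∀ a ∈ T, 0 < a)
    (hd : Dom T S) (hss : S' ⊂ S) (a : ℕ) (ha : (S \ S').min = some a) :
    ∃ b, (tri T S \ tri T S').min = some b ∧
      tri T (S.erase a) = (tri T S).erase b := by
  have hmem : a ∈ S \ S' := Finset.mem_of_min ha
  rw [Finset.mem_sdiff] at hmem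
  have hmin : ∀ x ∈ S \ S', a ≤ x := fun x hx => Finset.min_le_of_eq hx ha
  have hH := hall_of_dom T S hd
  obtain ⟨N, hN⟩ : ∃ N, ∀ x ∈ S ∪ T, x < N :=
    ⟨(S ∪ T).sup id + 1, fun x hx => Nat.lt_succ_of_le (Finset.le_sup (f := id) hx)⟩
  have hTN : T.filter (· < N) = T :=
    Finset.filter_true_of_mem fun x hx => hN x (Finset.mem_union_right _ hx)
  have key : ∀ U ⊆ S, tri T U = gq T U N 0 := by
    intro U hU
    have h := tri_gq T N U
    rw [hTN, Finset.filter_false_of_mem] at h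
    · simpa using h
    · intro x hx
      have := hN x (Finset.mem_union_left _ (hU hx))
      omega
  have hag : ∀ x < a, (x ∈ S ↔ x ∈ S') := by
    intro x hx
    refine ⟨fun h => ?_, fun h => hss.1 h⟩
    by_contra hc
    have := hmin x (Finset.mem_sdiff.2 ⟨h, hc⟩)
    omega
  have hJ : 0 + (S.filter (· < N)).card ≤ (T.filter (· < N)).card := by
    have h1 := hH N
    have h2 := filter_lt_succ S N
    omega
  obtain ⟨b, hb, hb', hc, he⟩ := phase1 T S S' a hmem.1 hmem.2 hss.1 hH hag N 0 0
    (hN a (Finset.mem_union_left _ hmem.1)) le_rfl hJ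
  rw [← key S subset_rfl, ← key S' hss.1, ← key _ (Finset.erase_subset _ _)] at *
  refine ⟨b, ?_, he⟩
  apply le_antisymm
  · exact Finset.min_le (Finset.mem_sdiff.2 ⟨hb, hb'⟩)
  · apply Finset.le_min
    intro c hcm
    rw [Finset.mem_sdiff] at hcm
    refine WithTop.coe_le_coe.2 ?_
    by_contra hlt
    exact hcm.2 (hc c hcm.1 (by omega))
end

section
/- Let U, T, S be finite sets of positive integers with U ⪯ T ⪯ S. Assume there exists a positive integer x ∉ T such that |U_{<x}| = |T_{<x}|, and assume there exists y ∈ T_{<x} such that (T ⊔ x) − y ⪯ S; let y be the smallest such element. Then for every subset S' ⊆ S, U ◁ (T ◁ S') = U ◁ (((T ⊔ x) − y) ◁ S'); consequently, U ◁ T = U ◁ ((T ⊔ x) − y). -/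
/-- number of elements of `X` that are at least `z` -/
def cge (X : Finset ℕ) (z : ℕ) : ℕ := (X.filter (fun t => z ≤ t)).card

/-- number of elements of `X` below `z` -/
def clt (X : Finset ℕ) (z : ℕ) : ℕ := (X.filter (fun t => t < z)).card

lemma cge_add_clt (X : Finset ℕ) (z : ℕ) : cge X z + clt X z = X.card := by
  unfold cge clt
  have := Finset.card_filter_add_card_filter_not (s := X) (fun t => z ≤ t)
  simpa only [not_le] using this

lemma clt_succ (X : Finset ℕ) (z : ℕ) : clt X (z+1) = clt X z + if z ∈ X then 1 else 0 := by
  unfold clt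
  split_ifs with h
  · have : X.filter (fun t => t < z+1) = insert z (X.filter (fun t => t < z)) := by
      ext a; simp only [Finset.mem_filter, Finset.mem_insert]; grind
    rw [this, Finset.card_insert_of_notMem (by simp)]
  · congr 1; ext a; simp only [Finset.mem_filter]; grind

lemma clt_mono (X : Finset ℕ) {a b : ℕ} (h : a ≤ b) : clt X a ≤ clt X b := by
  unfold clt
  apply Finset.card_le_card
  intro t; simp only [Finset.mem_filter]; grind

lemma cge_succ (X : Finset ℕ) (z : ℕ) : cge X z = cge X (z+1) + if z ∈ X then 1 else 0 := by
  have h1 := cge_add_clt X z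
  have h2 := cge_add_clt X (z+1)
  have h3 := clt_succ X z
  omega

lemma cge_mem {X : Finset ℕ} {z : ℕ} (h : z ∈ X) : cge X z = cge X (z+1) + 1 := by
  rw [cge_succ, if_pos h]

lemma cge_notMem {X : Finset ℕ} {z : ℕ} (h : z ∉ X) : cge X z = cge X (z+1) := by
  rw [cge_succ, if_neg h]; rfl

lemma cge_eq_zero (X : Finset ℕ) {z : ℕ} (h : ∀ t ∈ X, t < z) : cge X z = 0 := by
  unfold cge
  rw [Finset.card_eq_zero, Finset.filter_eq_empty_iff]
  intro t ht; have := h t ht; omega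

lemma cge_large (X Y Z W : Finset ℕ) : ∃ N, ∀ z, N ≤ z →
    cge X z = 0 ∧ cge Y z = 0 ∧ cge Z z = 0 ∧ cge W z = 0 := by
  refine ⟨(X ∪ Y ∪ Z ∪ W).sup id + 1, fun z hz => ?_⟩
  have key : ∀ t ∈ X ∪ Y ∪ Z ∪ W, t < z := fun t ht => by
    have := Finset.le_sup (f := id) ht
    simp only [id] at this; omega
  refine ⟨?_, ?_, ?_, ?_⟩ <;> refine cge_eq_zero _ fun t ht => key t ?_ <;>
    simp [ht]

lemma ext_cge {X Y : Finset ℕ} (h : ∀ z, cge X z = cge Y z) : X = Y := by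
  ext z
  have h1 := h z
  have h2 := h (z+1)
  by_cases a : z ∈ X <;> by_cases b : z ∈ Y <;> simp only [a, b]
  · rw [cge_mem a, cge_notMem b] at h1; omega
  · rw [cge_notMem a, cge_mem b] at h1; omega

/-- downward induction -/
lemma down {P : ℕ → Prop} (N m : ℕ) (hN : ∀ z, N ≤ z → P z)
    (h : ∀ z, m ≤ z → P (z+1) → P z) : ∀ z, m ≤ z → P z := by
  intro z hz
  by_cases hzN : N ≤ z
  · exact hN z hzN
  · refine Nat.decreasingInduction' (m := z) (n := N) (fun k _ hk hP => h k (by omega) hP)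
      (by omega) (hN N le_rfl)

lemma tri_sub (T S : Finset ℕ) : tri T S ⊆ T := by
  induction hn : S.card generalizing S T with
  | zero =>
    have : S = ∅ := Finset.card_eq_zero.mp hn
    subst this
    rw [tri]; simp
  | succ n ih =>
    rw [tri]
    split_ifs with hS hT
    · intro a ha
      rw [Finset.mem_insert] at ha
      rcases ha with rfl | ha
      · exact (Finset.mem_filter.mp (Finset.max'_mem _ hT)).1
      · have := ih _ (S.erase (S.max' hS))
          (by rw [Finset.card_erase_of_mem (S.max'_mem hS)]; omega) ha
        exact (Finset.mem_filter.mp this).1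
    · simp
    · simp

lemma mem_tri (T S : Finset ℕ) (t : ℕ) :
    t ∈ tri T S ↔ t ∈ T ∧ cge (tri T S) (t+1) < cge S (t+1) := by
  induction hn : S.card generalizing S T t with
  | zero =>
    have : S = ∅ := Finset.card_eq_zero.mp hn
    subst this
    rw [tri]; simp [cge]
  | succ n ih =>
    have hS : S.Nonempty := by rw [← Finset.card_pos]; omega
    have hmS := S.max'_mem hS
    have hmax : ∀ a ∈ S, a ≤ S.max' hS := fun a ha => S.le_max' a ha
    by_cases hT : (T.filter (fun t => t < S.max' hS)).Nonempty
    · have h1 : tri T S = insert ((T.filter (fun t => t < S.max' hS)).max' hT)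
        (tri (T.filter (fun t => t < (T.filter (fun t => t < S.max' hS)).max' hT))
          (S.erase (S.max' hS))) := by
        rw [tri, dif_pos hS, dif_pos hT]
      have htm := Finset.mem_filter.mp (Finset.max'_mem _ hT)
      have htx : ∀ a ∈ T.filter (fun t => t < S.max' hS),
          a ≤ (T.filter (fun t => t < S.max' hS)).max' hT :=
        fun a ha => (T.filter (fun t => t < S.max' hS)).le_max' a ha
      generalize (T.filter (fun t => t < S.max' hS)).max' hT = t1 at *
      generalize S.max' hS = m at *
      have hih := fun t => ih (T.filter (fun t => t < t1)) (S.erase m) t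
          (by rw [Finset.card_erase_of_mem hmS]; omega)
      have hsub := tri_sub (T.filter (fun t => t < t1)) (S.erase m)
      generalize tri (T.filter (fun t => t < t1)) (S.erase m) = A1 at *
      rw [h1]
      have hA1 : ∀ a ∈ A1, a < t1 := fun a ha => (Finset.mem_filter.mp (hsub ha)).2
      rcases lt_trichotomy t t1 with h | h | h
      · have e1 : cge S (t+1) = cge (S.erase m) (t+1) + 1 := by
          unfold cge
          have : S.filter (fun a => t + 1 ≤ a) =
              insert m ((S.erase m).filter (fun a => t + 1 ≤ a)) := by
            ext a; simp only [Finset.mem_filter, Finset.mem_insert, Finset.mem_erase]; grind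
          rw [this, Finset.card_insert_of_notMem (by simp)]
        have e2 : cge (insert t1 A1) (t+1) = cge A1 (t+1) + 1 := by
          unfold cge
          have : (insert t1 A1).filter (fun a => t + 1 ≤ a) =
              insert t1 (A1.filter (fun a => t + 1 ≤ a)) := by
            ext a; simp only [Finset.mem_filter, Finset.mem_insert]; grind
          rw [this, Finset.card_insert_of_notMem]
          intro h'
          have := hA1 t1 (Finset.mem_filter.mp h').1
          omega
        have := hih t
        rw [e1, e2, Finset.mem_insert, this, Finset.mem_filter]
        constructor
        · rintro (h' | h')
          · omega
          · exact ⟨h'.1.1, by omega⟩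
        · rintro ⟨h1, h2⟩
          exact Or.inr ⟨⟨h1, h⟩, by omega⟩
      · subst h
        have e1 : cge (insert t A1) (t+1) = 0 := by
          apply cge_eq_zero
          intro a ha
          rcases Finset.mem_insert.mp ha with rfl | ha
          · omega
          · have := hA1 a ha; omega
        have e2 : 0 < cge S (t+1) := by
          unfold cge; rw [Finset.card_pos]
          exact ⟨m, Finset.mem_filter.mpr ⟨hmS, htm.2⟩⟩
        simp only [Finset.mem_insert, true_or, true_iff]
        exact ⟨htm.1, by omega⟩
      · constructor
        · intro h'
          rcases Finset.mem_insert.mp h' with rfl | ha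
          · omega
          · have := hA1 t ha; omega
        · rintro ⟨h1, h2⟩
          exfalso
          have : cge S (t+1) = 0 := by
            apply cge_eq_zero
            intro a ha
            have := hmax a ha
            by_contra hc
            have := htx t (Finset.mem_filter.mpr ⟨h1, by omega⟩)
            omega
          omega
    · have h1 : tri T S = ∅ := by
        rw [tri, dif_pos hS, dif_neg hT]
      rw [h1]
      simp only [Finset.notMem_empty, false_iff, not_and, not_lt]
      intro ht
      have : cge S (t+1) = 0 := by
        apply cge_eq_zero
        intro a ha
        have := hmax a ha
        by_contra hc
        exact hT ⟨t, Finset.mem_filter.mpr ⟨ht, by omega⟩⟩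
      omega

lemma tri_cge_le (T S : Finset ℕ) (z : ℕ) : cge (tri T S) z ≤ cge S (z+1) := by
  obtain ⟨N, hN⟩ := cge_large (tri T S) S S S
  refine down (P := fun z => cge (tri T S) z ≤ cge S (z+1)) N 0 (fun z hz => ?_) (fun z _ h => ?_)
    z (Nat.zero_le _)
  · simp [(hN z hz).1]
  · have h0 := cge_succ S (z+1)
    by_cases hm : z ∈ tri T S
    · have := (mem_tri T S z).mp hm
      rw [cge_mem hm]; omega
    · rw [cge_notMem hm]; omega

lemma nth_mem {S : Finset ℕ} {i : ℕ} (h1 : 1 ≤ i) (h2 : i ≤ S.card) :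
    nth S i ∈ S ∧ clt S (nth S i) = i - 1 := by
  have hlen : (S.sort (· ≤ ·)).length = S.card := Finset.length_sort _
  have e : nth S i = S.orderEmbOfFin rfl ⟨i-1, by omega⟩ := by
    unfold nth
    rw [List.getD_eq_getElem _ _ (by omega)]
    rw [Finset.orderEmbOfFin_apply]
    rfl
  rw [e]
  refine ⟨Finset.orderEmbOfFin_mem _ _ _, ?_⟩
  unfold clt
  have : S.filter (fun t => t < S.orderEmbOfFin rfl ⟨i-1, by omega⟩) =
      (Finset.Iio (⟨i-1, by omega⟩ : Fin S.card)).map (S.orderEmbOfFin rfl).toEmbedding := by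
    ext a
    simp only [Finset.mem_filter, Finset.mem_map, Finset.mem_Iio]
    constructor
    · rintro ⟨ha, hlt⟩
      have : a ∈ Set.range (S.orderEmbOfFin rfl) := by
        rw [Finset.range_orderEmbOfFin]; exact ha
      obtain ⟨j, rfl⟩ := this
      exact ⟨j, (S.orderEmbOfFin rfl).lt_iff_lt.mp hlt, rfl⟩
    · rintro ⟨j, hj, rfl⟩
      exact ⟨Finset.orderEmbOfFin_mem _ _ _, (S.orderEmbOfFin rfl).lt_iff_lt.mpr hj⟩
  rw [this, Finset.card_map, Fin.card_Iio]

lemma clt_le_card (S : Finset ℕ) (z : ℕ) : clt S z ≤ S.card := by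
  have := cge_add_clt S z; omega

lemma dom_iff_s12 (T S : Finset ℕ) : Dom T S ↔ ∀ z, clt S (z+1) ≤ clt T z := by
  constructor
  · rintro ⟨h1, h2⟩ z
    by_contra hc
    have hk := clt_le_card S (z+1)
    have hS := nth_mem (S := S) (i := clt S (z+1)) (by omega) hk
    have hT := nth_mem (S := T) (i := clt S (z+1)) (by omega) (by omega)
    have hlt := h2 (clt S (z+1)) (by omega) hk
    have a1 := clt_succ T (nth T (clt S (z+1)))
    rw [if_pos hT.1] at a1
    have a2 : z < nth T (clt S (z+1)) + 1 := by
      by_contra hh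
      have := clt_mono T (a := nth T (clt S (z+1)) + 1) (b := z) (by omega)
      omega
    have := clt_mono S (a := z + 1) (b := nth S (clt S (z+1))) (by omega)
    omega
  · intro h
    constructor
    · obtain ⟨N, hN⟩ := cge_large S S S S
      have h1 := h N
      have h2 := (hN (N+1) (by omega)).1
      have h3 := cge_add_clt S (N+1)
      have := clt_le_card T N
      omega
    · intro i h1 h2
      have hS := nth_mem h1 h2
      have a1 := clt_succ S (nth S i)
      rw [if_pos hS.1] at a1
      have a2 := h (nth S i)
      have a3 := clt_le_card T (nth S i)
      have hT := nth_mem (S := T) h1 (by omega)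
      by_contra hc
      have := clt_mono T (a := nth S i) (b := nth T i) (by omega)
      omega

lemma swap_mem {T : Finset ℕ} {x y t : ℕ} (h1 : t ≠ x) (h2 : t ≠ y) :
    t ∈ insert x (T.erase y) ↔ t ∈ T := by simp [h1, h2]

lemma clt_swap {T : Finset ℕ} {x y : ℕ} (hxT : x ∉ T) (hyT : y ∈ T) (hyx : y < x) (z : ℕ) :
    clt T z = clt (insert x (T.erase y)) z + if y < z ∧ z ≤ x then 1 else 0 := by
  induction z with
  | zero => simp [clt]
  | succ z ih =>
    rw [clt_succ, clt_succ, ih]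
    by_cases h1 : z = x
    · subst h1
      simp [hxT]; omega
    by_cases h2 : z = y
    · subst h2
      simp [hyT, h1]; omega
    · simp only [swap_mem h1 h2]
      split_ifs <;> omega

lemma cge_sub_mono {S' S : Finset ℕ} (h : S' ⊆ S) {a b : ℕ} (hab : a ≤ b) :
    cge S' a + cge S b ≤ cge S a + cge S' b := by
  induction b, hab using Nat.le_induction with
  | base => omega
  | succ b hb ih =>
    have h1 := cge_succ S b
    have h2 := cge_succ S' b
    by_cases hm : b ∈ S'
    · rw [if_pos hm] at h2; rw [if_pos (h hm)] at h1; omega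
    · rw [if_neg hm] at h2; split_ifs at h1 <;> omega

/-- If two sets differ by a suitable swap, then `U ◁ A = U ◁ B`. -/
lemma tri_swap (U T A B : Finset ℕ) (x t0 : ℕ) (ht0 : t0 < x)
    (hU : ∀ t, t < x → cge U t + cge T x ≤ cge T (t+1) + cge U x)
    (hxA : x ∉ A)
    (hTA : ∀ t, t0 < t → t < x → t ∈ T → t ∈ A)
    (h1 : ∀ z, x < z → cge A z = cge B z)
    (h2 : ∀ z, t0 < z → z ≤ x → cge B z = cge A z + 1)
    (h3 : ∀ z, z ≤ t0 → cge A z = cge B z) : tri U A = tri U B := by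
  apply ext_cge
  obtain ⟨N, hN⟩ := cge_large (tri U A) (tri U B) A B
  have hAT : ∀ t, t0 < t → t ≤ x → cge T t + cge A x ≤ cge A t + cge T x := by
    intro t ht htx
    refine Nat.decreasingInduction' (m := t) (n := x)
      (P := fun t => cge T t + cge A x ≤ cge A t + cge T x) ?_ htx (by omega)
    intro k hk htk ih
    have a1 := cge_succ T k
    have a2 := cge_succ A k
    split_ifs at a1 a2 with b1 b2
    · omega
    · exact absurd (hTA k (by omega) hk b1) b2
    · omega
    · omega
  have hVU : ∀ t, t ≤ x → cge (tri U A) t + cge U x ≤ cge U t + cge (tri U A) x := by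
    intro t ht
    have := cge_sub_mono (tri_sub U A) ht
    omega
  have hVx := tri_cge_le U A x
  have hAx := cge_notMem hxA
  have hpick : ∀ t, t0 ≤ t → t < x → t ∈ U → t ∈ tri U A := by
    intro t ht htx htU
    rw [mem_tri]
    refine ⟨htU, ?_⟩
    have b1 := hVU (t+1) (by omega)
    have b2 := hAT (t+1) (by omega) (by omega)
    have b3 := hU t htx
    rw [cge_mem htU] at b3
    omega
  intro z
  refine down (P := fun z => cge (tri U A) z = cge (tri U B) z) N 0 (fun z hz => ?_)
    (fun z _ ih => ?_) z (Nat.zero_le _)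
  · have := hN z hz; omega
  · have hiff : z ∈ tri U A ↔ z ∈ tri U B := by
      by_cases hz : t0 ≤ z ∧ z < x
      · constructor
        · intro h
          have := (mem_tri _ _ _).mp h
          have b := h2 (z+1) (by omega) (by omega)
          rw [mem_tri]
          exact ⟨this.1, by omega⟩
        · intro h
          exact hpick z hz.1 hz.2 (tri_sub _ _ h)
      · have : cge A (z+1) = cge B (z+1) := by
          by_cases hx : x < z+1
          · exact h1 _ hx
          · exact h3 _ (by omega)
        rw [mem_tri, mem_tri, this, ih]
    simp only [cge_succ (tri U A) z, cge_succ (tri U B) z, ih, hiff]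

/-- `y` is not picked once the queue is empty somewhere in `(y, x]`. -/
lemma not_picked (T S' : Finset ℕ) (x y : ℕ)
    (hall : ∀ w, y < w → w ≤ x → cge S' (y+1) + cge T w ≤ cge T (y+1) + cge S' (w+1))
    (w : ℕ) (hyw : y < w) (hwx : w ≤ x) (hw : cge (tri T S') w = cge S' (w+1)) :
    y ∉ tri T S' := by
  intro hy
  have hy' := ((mem_tri _ _ _).mp hy).2
  have hex : ∃ w, y < w ∧ w ≤ x ∧ cge (tri T S') w = cge S' (w+1) := ⟨w, hyw, hwx, hw⟩
  classical
  obtain ⟨h1, h2, h3⟩ := Nat.find_spec hex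
  have hmin := fun m => Nat.find_min hex (m := m)
  generalize Nat.find hex = v at *
  have key : cge T (y+1) + cge (tri T S') v ≤ cge (tri T S') (y+1) + cge T v := by
    refine Nat.decreasingInduction' (m := y+1) (n := v)
      (P := fun t => cge T t + cge (tri T S') v ≤ cge (tri T S') t + cge T v) ?_ h1 (by omega)
    intro k hk hyk ih
    have a1 := cge_succ T k
    have a2 := cge_succ (tri T S') k
    have a3 := tri_cge_le T S' k
    have a4 : cge (tri T S') k ≠ cge S' (k+1) := fun h => hmin k hk ⟨hyk, by omega, h⟩
    have a5 := mem_tri T S' k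
    by_cases hkT : k ∈ T
    · have : k ∈ tri T S' := a5.mpr ⟨hkT, by split_ifs at a2 <;> omega⟩
      rw [if_pos this] at a2; rw [if_pos hkT] at a1; omega
    · rw [if_neg hkT] at a1; omega
  have := hall v h1 h2
  omega

lemma tri_compare (T S' : Finset ℕ) (x y : ℕ) (hxT : x ∉ T) (hyT : y ∈ T) (hyx : y < x)
    (hall : ∀ w, y < w → w ≤ x → cge S' (y+1) + cge T w ≤ cge T (y+1) + cge S' (w+1)) :
    tri T S' = tri (insert x (T.erase y)) S' ∨ ∃ t0, t0 < x ∧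
    (∀ t, t0 < t → t < x → t ∈ T → t ∈ tri T S') ∧
    (∀ z, x < z → cge (tri T S') z = cge (tri (insert x (T.erase y)) S') z) ∧
    (∀ z, t0 < z → z ≤ x → cge (tri (insert x (T.erase y)) S') z = cge (tri T S') z + 1) ∧
    (∀ z, z ≤ t0 → cge (tri T S') z = cge (tri (insert x (T.erase y)) S') z) := by
  have hnp := not_picked T S' x y hall
  have hmA := mem_tri T S'
  have hmB := mem_tri (insert x (T.erase y)) S'
  have hleB := tri_cge_le (insert x (T.erase y)) S'
  have hleA := tri_cge_le T S'
  obtain ⟨N, hN⟩ := cge_large (tri T S') (tri (insert x (T.erase y)) S') S' S'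
  have hxT' : x ∈ insert x (T.erase y) := by simp
  have hyT' : y ∉ insert x (T.erase y) := by simp; omega
  have hsw : ∀ t, t ≠ x → t ≠ y → (t ∈ insert x (T.erase y) ↔ t ∈ T) := fun t => swap_mem
  generalize tri T S' = A at *
  generalize tri (insert x (T.erase y)) S' = B at *
  generalize insert x (T.erase y) = T' at *
  have hxA : x ∉ A := fun h => hxT ((hmA x).mp h).1
  have hyB : y ∉ B := fun h => hyT' ((hmB y).mp h).1
  -- one step where the counts agree
  have step : ∀ z, z ≠ x → z ≠ y → cge A (z+1) = cge B (z+1) → cge A z = cge B z := by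
    intro z hzx hzy h
    have : z ∈ A ↔ z ∈ B := by rw [hmA, hmB, hsw z hzx hzy, h]
    rw [cge_succ A z, cge_succ B z, h]; simp only [this]
  -- propagation down from an agreeing level
  have prop : ∀ w, w ≤ x → cge A w = cge B w → (y < w → y ∉ A) →
      ∀ z, z ≤ w → cge A z = cge B z := by
    intro w hw h hyA z hz
    refine Nat.decreasingInduction' (m := z) (n := w) (P := fun z => cge A z = cge B z) ?_ hz h
    intro k hk _ ih
    by_cases hky : k = y
    · subst hky
      rw [cge_notMem (hyA hk), cge_notMem hyB, ih]
    · exact step k (by omega) hky ih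
  have habove : ∀ z, x + 1 ≤ z → cge A z = cge B z := by
    refine down N (x+1) (fun z hz => ?_) (fun z hz ih => step z (by omega) (by omega) ih)
    have := hN z hz; omega
  have hx1 := habove (x+1) le_rfl
  by_cases hq : x ∈ B
  · right
    have hq' := (hmB x).mp hq
    have hex : ∃ t, t < x ∧ y ≤ t ∧ t ∈ T ∧ (t = y ∨ cge B (t+1) = cge S' (t+1)) :=
      ⟨y, hyx, le_rfl, hyT, Or.inl rfl⟩
    obtain ⟨t0, ⟨c1, c2, c3, c4⟩, hmax⟩ : ∃ t0, (t0 < x ∧ y ≤ t0 ∧ t0 ∈ T ∧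
        (t0 = y ∨ cge B (t0+1) = cge S' (t0+1))) ∧
        ∀ t, t0 < t → t < x → t ∈ T → cge B (t+1) ≠ cge S' (t+1) := by
      classical
      have hs := Nat.findGreatest_spec (P := fun t => t < x ∧ y ≤ t ∧ t ∈ T ∧
        (t = y ∨ cge B (t+1) = cge S' (t+1))) (n := x) (m := y) hyx.le
        ⟨hyx, le_rfl, hyT, Or.inl rfl⟩
      refine ⟨_, hs, fun t h1 h2 h3 h4 => ?_⟩
      exact Nat.findGreatest_is_greatest h1 h2.le ⟨h2, by omega, h3, Or.inr h4⟩
    have hgap : ∀ z, t0 < z → z ≤ x → cge B z = cge A z + 1 := by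
      intro z hz hzx
      refine Nat.decreasingInduction' (m := z) (n := x) (P := fun z => cge B z = cge A z + 1)
        ?_ hzx ?_
      · intro k hk hzk ih
        have : k ∈ A ↔ k ∈ B := by
          rw [hmA, hmB, hsw k (by omega) (by omega)]
          have d1 := hleB (k+1)
          have d2 := cge_succ S' (k+1)
          constructor
          · rintro ⟨e1, e2⟩
            have := hmax k (by omega) hk e1
            exact ⟨e1, by omega⟩
          · rintro ⟨e1, e2⟩
            exact ⟨e1, by omega⟩
        rw [cge_succ A k, cge_succ B k, ih]; simp only [this]; omega
      · rw [cge_mem hq, cge_notMem hxA, hx1]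
    have g1 := hgap (t0+1) (by omega) c1
    have d1 := hleB (t0+1)
    have d2 := cge_succ S' (t0+1)
    have ht0A : t0 ∈ A := (hmA t0).mpr ⟨c3, by omega⟩
    have ht0B : t0 ∉ B := by
      rcases c4 with rfl | c4
      · exact hyB
      · intro h; have := ((hmB t0).mp h).2; omega
    have e0 : cge A t0 = cge B t0 := by
      rw [cge_mem ht0A, cge_notMem ht0B, g1]
    refine ⟨t0, c1, ?_, fun z hz => habove z hz, hgap, prop t0 c1.le e0 ?_⟩
    · intro t h1 h2 h3
      have f1 := hgap (t+1) (by omega) h2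
      have f2 := hleB (t+1)
      have f3 := cge_succ S' (t+1)
      exact (hmA t).mpr ⟨h3, by omega⟩
    · intro hyt
      have c4' : cge B (t0+1) = cge S' (t0+1) := by
        rcases c4 with h | h
        · omega
        · exact h
      refine hnp t0 hyt c1.le ?_
      rw [cge_mem ht0A]; omega
  · left
    have hq' : ¬ cge B (x+1) < cge S' (x+1) := fun h => hq ((hmB x).mpr ⟨hxT', h⟩)
    have e0 : cge A x = cge B x := by rw [cge_notMem hxA, cge_notMem hq, hx1]
    have hyA : y ∉ A := by
      refine hnp x hyx le_rfl ?_
      have := hleA x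
      have := cge_notMem hxA
      omega
    apply ext_cge
    intro z
    by_cases hz : x + 1 ≤ z
    · exact habove z hz
    · exact prop x le_rfl e0 (fun _ => hyA) z (by omega)

theorem stmt12 (S T U : Finset ℕ) (hSpos : ∀ a ∈ S, 0 < a) (hTpos : ∀ a ∈ T, 0 < a)
    (hUpos : ∀ a ∈ U, 0 < a)
    (hUT : Dom U T) (hTS : Dom T S)
    (x : ℕ) (hx : 0 < x) (hxT : x ∉ T)
    (hc : (U.filter (· < x)).card = (T.filter (· < x)).card)
    (y : ℕ) (hyT : y ∈ T) (hyx : y < x)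
    (hyd : Dom (insert x (T.erase y)) S)
    (hymin : ∀ y' ∈ T, y' < x → Dom (insert x (T.erase y')) S → y ≤ y') :
    (∀ S' ⊆ S, tri U (tri T S') = tri U (tri (insert x (T.erase y)) S')) ∧
    tri U T = tri U (insert x (T.erase y)) := by
  have hc' : clt U x = clt T x := hc
  rw [dom_iff_s12] at hUT hTS hyd
  have hU : ∀ t, t < x → cge U t + cge T x ≤ cge T (t+1) + cge U x := by
    intro t ht
    have a1 := cge_add_clt U t
    have a2 := cge_add_clt U x
    have a3 := cge_add_clt T (t+1)
    have a4 := cge_add_clt T x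
    have := hUT t
    omega
  have hcs := fun z => clt_swap hxT hyT hyx z
  have tight : clt T y ≤ clt S (y+1) := by
    by_contra hlt
    push Not at hlt
    have hne : (T.filter (fun t => t < y)).Nonempty := by
      rw [← Finset.card_pos]; unfold clt at hlt; omega
    obtain ⟨y', hy', hmax⟩ := (T.filter (fun t => t < y)).exists_max_image id hne
    rw [Finset.mem_filter] at hy'
    have hcontr := hymin y' hy'.1 (by omega) (by
      rw [dom_iff_s12]
      intro z
      have b1 := clt_swap hxT hy'.1 (by omega) z
      have b2 := hcs z
      have b3 := hTS z
      have b4 := hyd z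
      by_cases hz : y' < z ∧ z ≤ y
      · have : clt T z = clt T y := by
          unfold clt
          congr 1
          ext a
          simp only [Finset.mem_filter]
          constructor
          · rintro ⟨h1, h2⟩; exact ⟨h1, by omega⟩
          · rintro ⟨h1, h2⟩
            have := hmax a (Finset.mem_filter.mpr ⟨h1, h2⟩)
            simp only [id] at this
            exact ⟨h1, by omega⟩
        have := clt_mono S (a := z+1) (b := y+1) (by omega)
        split_ifs at b1 <;> omega
      · split_ifs at b1 b2 <;> omega)
    omega
  refine ⟨fun S' hS' => ?_, ?_⟩
  · have hall : ∀ w, y < w → w ≤ x →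
        cge S' (y+1) + cge T w ≤ cge T (y+1) + cge S' (w+1) := by
      intro w h1 h2
      have a0 := cge_sub_mono hS' (a := y+1) (b := w+1) (by omega)
      have a1 := cge_add_clt S (y+1)
      have a2 := cge_add_clt S (w+1)
      have a3 := cge_add_clt T (y+1)
      have a4 := cge_add_clt T w
      have a5 := clt_succ T y
      rw [if_pos hyT] at a5
      have a6 := hyd w
      have a7 := hcs w
      rw [if_pos ⟨h1, h2⟩] at a7
      omega
    rcases tri_compare T S' x y hxT hyT hyx hall with h | ⟨t0, h1, h2, h3, h4, h5⟩
    · rw [h]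
    · exact tri_swap U T _ _ x t0 h1 hU (fun h => hxT (tri_sub _ _ h)) h2 h3 h4 h5
  · have hcard : (insert x (T.erase y)).card = T.card := by
      rw [Finset.card_insert_of_notMem (by simp [hxT]), Finset.card_erase_of_mem hyT]
      have := Finset.card_pos.mpr ⟨y, hyT⟩
      omega
    have hg : ∀ z, cge (insert x (T.erase y)) z = cge T z + if y < z ∧ z ≤ x then 1 else 0 := by
      intro z
      have a1 := cge_add_clt T z
      have a2 := cge_add_clt (insert x (T.erase y)) z
      have := hcs z
      omega
    refine tri_swap U T _ _ x y hyx hU hxT (fun _ _ _ h => h) ?_ ?_ ?_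
    · intro z hz; rw [hg, if_neg (by omega)]; rfl
    · intro z h1 h2; rw [hg, if_pos ⟨h1, h2⟩]
    · intro z hz; rw [hg, if_neg (by omega)]; rfl
end

section
/- Let U and T be finite sets of positive integers with |U| ≤ |T|, set δ = |T| − |U|, and suppose that U(i) < T(i + δ) for every 1 ≤ i ≤ |U|. Let x be a positive integer with x > max(T). Then: (i) U ◁ (T ⊔ x) = U ◁ T = U; (ii) for every proper subset T' ⊊ T, setting x' = max(T \ T'), one has U ◁ (T' ⊔ x) = U ◁ (T' ⊔ x'). -/
theorem tri_empty_left (S : Finset ℕ) : tri ∅ S = ∅ := by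
  rw [tri]; simp

theorem max'_insert_of_lt (S : Finset ℕ) (s : ℕ) (hs : ∀ a ∈ S, a < s)
    (hne : (insert s S).Nonempty) : (insert s S).max' hne = s := by
  apply le_antisymm
  · apply Finset.max'_le
    intro y hy
    rcases Finset.mem_insert.1 hy with rfl | hy
    · exact le_rfl
    · exact (hs y hy).le
  · exact Finset.le_max' _ _ (Finset.mem_insert_self _ _)

theorem tri_step_s14 (U S : Finset ℕ) (u s : ℕ) (hu : ∀ a ∈ U, a < u) (hs : ∀ a ∈ S, a < s)
    (hus : u < s) : tri (insert u U) (insert s S) = insert u (tri U S) := by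
  have h1 : (insert s S).Nonempty := Finset.insert_nonempty _ _
  have h2 := max'_insert_of_lt S s hs h1
  have h3 : (insert u U).filter (fun t => t < s) = insert u U := by
    apply Finset.filter_true_of_mem
    intro y hy
    rcases Finset.mem_insert.1 hy with rfl | hy
    · exact hus
    · exact (hu y hy).trans hus
  have h5 : (insert u U).filter (fun t => t < u) = U := by
    ext y
    simp only [Finset.mem_filter, Finset.mem_insert]
    constructor
    · rintro ⟨rfl | h, h'⟩
      · exact absurd h' (lt_irrefl _)
      · exact h
    · exact fun h => ⟨Or.inr h, hu y h⟩
  have h6 : (insert s S).erase s = S :=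
    Finset.erase_insert (fun h => lt_irrefl _ (hs s h))
  rw [tri, dif_pos h1]
  simp only [h2, h3, h6, max'_insert_of_lt U u hu, h5, Finset.insert_nonempty, dite_true]

theorem sort_insert_max (S : Finset ℕ) (s : ℕ) (hs : ∀ a ∈ S, a < s) :
    (insert s S).sort (· ≤ ·) = S.sort (· ≤ ·) ++ [s] := by
  have hn : s ∉ S := fun h => lt_irrefl _ (hs s h)
  apply List.Perm.eq_of_pairwise (le := (· ≤ ·))
  · intro a b _ _ h1 h2
    exact le_antisymm h1 h2
  · exact Finset.pairwise_sort _ _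
  · rw [List.pairwise_append]
    refine ⟨Finset.pairwise_sort _ _, by simp, ?_⟩
    intro a ha b hb
    simp at ha hb
    subst hb
    exact (hs a ha).le
  · rw [← Multiset.coe_eq_coe, ← Multiset.coe_add, Finset.sort_eq, Finset.sort_eq,
      Finset.insert_val_of_notMem hn, Multiset.coe_singleton, add_comm, Multiset.singleton_add]

theorem nth_insert_lt (S : Finset ℕ) (s : ℕ) (hs : ∀ a ∈ S, a < s) (i : ℕ) (h1 : 1 ≤ i)
    (hi : i ≤ S.card) : nth (insert s S) i = nth S i := by
  unfold nth
  rw [sort_insert_max S s hs, List.getD_append]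
  rw [Finset.length_sort]; omega

theorem nth_insert_last (S : Finset ℕ) (s : ℕ) (hs : ∀ a ∈ S, a < s) :
    nth (insert s S) (S.card + 1) = s := by
  unfold nth
  rw [sort_insert_max S s hs, List.getD_append_right] <;> simp

theorem stmt14_aux (T : Finset ℕ) : ∀ (U : Finset ℕ), U.card ≤ T.card →
    (∀ i, 1 ≤ i → i ≤ U.card → nth U i < nth T (i + (T.card - U.card))) →
    ∀ x : ℕ, (∀ t ∈ T, t < x) →
    tri U (insert x T) = U ∧ tri U T = U ∧
    (∀ T', T' ⊂ T → ∀ x', x' ∈ T \ T' → (∀ y ∈ T \ T', y ≤ x') →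
      tri U (insert x T') = tri U (insert x' T')) := by
  induction T using Finset.induction_on_max with
  | empty =>
    intro U hc _ x _
    have : U = ∅ := by simpa using hc
    subst this
    simp [tri_empty_left]
  | insert t T ht ih =>
    intro U
    induction U using Finset.induction_on_max with
    | empty => intros; simp [tri_empty_left]
    | insert u U hu _ =>
      intro hc h x hx
      have hnT : t ∉ T := fun h => lt_irrefl _ (ht t h)
      have hnU : u ∉ U := fun h => lt_irrefl _ (hu u h)
      rw [Finset.card_insert_of_notMem hnT, Finset.card_insert_of_notMem hnU] at *
      have hut : u < t := by
        have := h (U.card + 1) (by omega) le_rfl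
        rwa [nth_insert_last U u hu,
          show U.card + 1 + (T.card + 1 - (U.card + 1)) = T.card + 1 by omega,
          nth_insert_last T t ht] at this
      have htx : t < x := hx t (Finset.mem_insert_self _ _)
      have hux := hut.trans htx
      obtain ⟨i1, i2, i3⟩ := ih U (by omega) (by
        intro i h1 hi
        have := h i h1 (by omega)
        rwa [nth_insert_lt U u hu i h1 hi, nth_insert_lt T t ht _ (by omega) (by omega),
          show i + (T.card + 1 - (U.card + 1)) = i + (T.card - U.card) by omega] at this) t ht
      refine ⟨?_, ?_, ?_⟩
      · rw [tri_step_s14 U _ u x hu hx hux, i1]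
      · rw [tri_step_s14 U _ u t hu ht hut, i2]
      · intro T' hT' x' hx' hmax
        have hT'x : ∀ a ∈ T', a < x := fun a ha => hx a (hT'.1 ha)
        rw [tri_step_s14 U _ u x hu hT'x hux]
        by_cases htT : t ∈ T'
        · obtain ⟨S, hS, rfl⟩ : ∃ S, t ∉ S ∧ T' = insert t S :=
            ⟨T'.erase t, Finset.notMem_erase _ _, (Finset.insert_erase htT).symm⟩
          have hST : S ⊆ T := by
            intro a ha
            rcases Finset.mem_insert.1 (hT'.1 (Finset.mem_insert_of_mem ha)) with rfl | h
            · exact absurd ha hS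
            · exact h
          have hd : insert t T \ insert t S = T \ S := by
            ext a
            simp only [Finset.mem_sdiff, Finset.mem_insert]
            constructor
            · tauto
            · rintro ⟨h1, h2⟩
              refine ⟨Or.inr h1, ?_⟩
              rintro (rfl | h3)
              · exact hnT h1
              · exact h2 h3
          rw [hd] at hx' hmax
          have hxx := Finset.mem_sdiff.1 hx'
          rw [Finset.insert_comm x' t, tri_step_s14 U (insert x' S) u t hu _ hut]
          · rw [i3 S ⟨hST, fun hc => hxx.2 (hc hxx.1)⟩ x' hx' hmax]
          · intro a ha
            rcases Finset.mem_insert.1 ha with rfl | ha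
            · exact ht _ hxx.1
            · exact ht _ (hST ha)
        · have hle := hmax t (Finset.mem_sdiff.2 ⟨Finset.mem_insert_self _ _, htT⟩)
          have hxt : x' = t := by
            rcases Finset.mem_insert.1 (Finset.mem_sdiff.1 hx').1 with h | h
            · exact h
            · exact absurd (ht _ h) (by omega)
          subst hxt
          rw [tri_step_s14 U T' u x' hu _ hut]
          intro a ha
          rcases Finset.mem_insert.1 (hT'.1 ha) with rfl | h
          · exact absurd ha htT
          · exact ht _ h

theorem stmt14 (T U : Finset ℕ) (hTpos : ∀ a ∈ T, 0 < a) (hUpos : ∀ a ∈ U, 0 < a)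
    (hc : U.card ≤ T.card)
    (h : ∀ i, 1 ≤ i → i ≤ U.card → nth U i < nth T (i + (T.card - U.card)))
    (x : ℕ) (hx : ∀ t ∈ T, t < x) :
    (tri U (insert x T) = tri U T ∧ tri U T = U) ∧
    (∀ T', T' ⊂ T → ∀ x', (T \ T').max = some x' →
      tri U (insert x T') = tri U (insert x' T')) := by
  obtain ⟨h1, h2, h3⟩ := stmt14_aux T U hc h x hx
  refine ⟨⟨h1.trans h2.symm, h2⟩, ?_⟩
  intro T' hT' x' hx'
  exact h3 T' hT' x' (Finset.mem_of_max hx') (fun y hy => Finset.le_max_of_eq hy hx')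
end
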